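/- Fixed points of the simple fixed point iteration are optimal: in the discrete setting, let α ∈ ℝ^N, β ∈ ℝ^M, define πᵢⱼ := (αᵢ + βⱼ − cᵢⱼ)₊ / γ, fᵢ := −γ·(∑ⱼ πᵢⱼ − μᵢ) and gⱼ := −γ·(∑ᵢ πᵢⱼ − νⱼ). If (α, β) is a fixed point of the iteration, i.e. fᵢ − (∑ₖ fₖ)/(2N) = 0 for all i and gⱼ − (∑ₖ gₖ)/(2M) = 0 for all j, then f = 0 and g = 0, and π is an optimal solution of the quadratically regularized discrete optimal transport problem. -/

import Mathlib

open Finset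

/-- Feasibility for the discrete transport problem: `π` is entrywise nonnegative with
row sums `μ` and column sums `ν`. -/
def IsFeasible {N M : ℕ} (μ : Fin N → ℝ) (ν : Fin M → ℝ)
    (π : Matrix (Fin N) (Fin M) ℝ) : Prop :=
  (∀ i j, 0 ≤ π i j) ∧ (∀ i, ∑ j, π i j = μ i) ∧ (∀ j, ∑ i, π i j = ν j)

/-- The quadratically regularized discrete transport cost. -/
noncomputable def quadCost {N M : ℕ} (c : Matrix (Fin N) (Fin M) ℝ) (γ : ℝ)
    (π : Matrix (Fin N) (Fin M) ℝ) : ℝ :=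
  (∑ i, ∑ j, c i j * π i j) + γ / 2 * ∑ i, ∑ j, π i j ^ 2

/-- A vector each of whose entries equals half of the mean of its entries is zero. -/
theorem eq_zero_of_sub_half_mean_eq_zero {n : ℕ} (f : Fin n → ℝ)
    (h : ∀ i, f i - (∑ k, f k) / (2 * (n : ℝ)) = 0) (i : Fin n) : f i = 0 := by
  have hn : (n : ℝ) ≠ 0 := Nat.cast_ne_zero.mpr i.pos.ne'
  have hsum : ∑ k, f k = n * ((∑ k, f k) / (2 * (n : ℝ))) := by
    conv_lhs => rw [sum_congr rfl fun k _ => sub_eq_zero.mp (h k)]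
    simp
  have hzero : ∑ k, f k = 0 := by
    have hhalf : n * ((∑ k, f k) / (2 * (n : ℝ))) = (∑ k, f k) / 2 := by field_simp
    linarith
  simpa [hzero] using h i

/-- Pairing a feasible plan with `αᵢ + βⱼ` depends only on the marginals. -/
theorem IsFeasible.sum_add_mul {N M : ℕ} {μ : Fin N → ℝ} {ν : Fin M → ℝ}
    {π : Matrix (Fin N) (Fin M) ℝ} (h : IsFeasible μ ν π) (α : Fin N → ℝ) (β : Fin M → ℝ) :
    ∑ i, ∑ j, (α i + β j) * π i j = ∑ i, α i * μ i + ∑ j, β j * ν j := by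
  simp only [add_mul, sum_add_distrib]
  congr 1
  · simp only [← mul_sum, h.2.1]
  · rw [sum_comm]
    simp only [← mul_sum, h.2.2]

/-- The point `s₊ / γ` with `s = a - c` minimizes `x ↦ (c - a) x + γ / 2 x²` over `0 ≤ x`. -/
theorem quadratic_le_of_eq_max_div {c γ a x y : ℝ} (hγ : 0 < γ)
    (hx : x = max (a - c) 0 / γ) (hy : 0 ≤ y) :
    c * x + γ / 2 * x ^ 2 - a * x ≤ c * y + γ / 2 * y ^ 2 - a * y := by
  have hγx : γ * x = max (a - c) 0 := by rw [hx]; field_simp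
  rcases le_total (a - c) 0 with hs | hs
  · have hx0 : x = 0 := by simp [hx, hs]
    subst hx0
    nlinarith [mul_nonneg (sub_nonneg.mpr hs) hy, mul_nonneg hγ.le (sq_nonneg y)]
  · rw [max_eq_left hs] at hγx
    have ha : a = c + γ * x := by linarith
    subst ha
    nlinarith [mul_nonneg hγ.le (sq_nonneg (y - x))]

/-- A feasible plan of the form `(αᵢ + βⱼ - cᵢⱼ)₊ / γ` is optimal. -/
theorem IsFeasible.quadCost_le {N M : ℕ} {μ : Fin N → ℝ} {ν : Fin M → ℝ}
    {c π π' : Matrix (Fin N) (Fin M) ℝ} {γ : ℝ} {α : Fin N → ℝ} {β : Fin M → ℝ} (hγ : 0 < γ)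
    (h : IsFeasible μ ν π) (hπ : ∀ i j, π i j = max (α i + β j - c i j) 0 / γ)
    (h' : IsFeasible μ ν π') : quadCost c γ π ≤ quadCost c γ π' := by
  have key := sum_le_sum fun i (_ : i ∈ univ) => sum_le_sum fun j (_ : j ∈ univ) =>
    quadratic_le_of_eq_max_div hγ (hπ i j) (h'.1 i j)
  simp only [sum_sub_distrib, sum_add_distrib, ← mul_sum, h.sum_add_mul, h'.sum_add_mul] at key
  exact (sub_le_sub_iff_right _).mp key

/-- Fixed points of the simple fixed point iteration are optimal: if the update directions
`fᵢ − (∑ₖ fₖ)/(2N)` and `gⱼ − (∑ₖ gₖ)/(2M)` all vanish, then `f = 0`, `g = 0`, and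
`πᵢⱼ = (αᵢ + βⱼ − cᵢⱼ)₊/γ` is an optimal solution. -/
theorem simple_fixed_point_optimal {N M : ℕ} (μ : Fin N → ℝ) (ν : Fin M → ℝ)
    (hμ : ∀ i, 0 ≤ μ i) (hν : ∀ j, 0 ≤ ν j) (hmass : ∑ i, μ i = ∑ j, ν j)
    (c : Matrix (Fin N) (Fin M) ℝ) (γ : ℝ) (hγ : 0 < γ)
    (α : Fin N → ℝ) (β : Fin M → ℝ)
    (π : Matrix (Fin N) (Fin M) ℝ) (hπ : ∀ i j, π i j = max (α i + β j - c i j) 0 / γ)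
    (f : Fin N → ℝ) (hf : ∀ i, f i = -γ * (∑ j, π i j - μ i))
    (g : Fin M → ℝ) (hg : ∀ j, g j = -γ * (∑ i, π i j - ν j))
    (hfixf : ∀ i, f i - (∑ k, f k) / (2 * (N : ℝ)) = 0)
    (hfixg : ∀ j, g j - (∑ k, g k) / (2 * (M : ℝ)) = 0) :
    (∀ i, f i = 0) ∧ (∀ j, g j = 0) ∧
    IsFeasible μ ν π ∧
    ∀ π', IsFeasible μ ν π' → quadCost c γ π ≤ quadCost c γ π' := by
  have hf0 := eq_zero_of_sub_half_mean_eq_zero f hfixf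
  have hg0 := eq_zero_of_sub_half_mean_eq_zero g hfixg
  have hfeas : IsFeasible μ ν π := by
    refine ⟨fun i j => ?_, fun i => ?_, fun j => ?_⟩
    · rw [hπ]
      positivity
    · have h := (hf i).symm.trans (hf0 i)
      simpa [hγ.ne', sub_eq_zero] using h
    · have h := (hg j).symm.trans (hg0 j)
      simpa [hγ.ne', sub_eq_zero] using h
  exact ⟨hf0, hg0, hfeas, fun _ h' => hfeas.quadCost_le hγ hπ h'⟩
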